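/- arXiv:0807.4059 — 3 statements merged into one kernel-verified Lean document; each statement's English description precedes it below -/
import Mathlib

section
/- Let f, g be nonnegative measurable functions on R^2 vanishing at infinity, with symmetric-decreasing rearrangements f*, g*. Let v : R^2 → R be a nonnegative spherically symmetric increasing function (i.e., v(x) depends only on |x| and is nondecreasing in |x|). Then ∫∫ f(x) v(x−y) g(y) dx dy ≥ ∫∫ f*(x) v(x−y) g*(y) dx dy. -/
open MeasureTheory

noncomputable section

/-- A function on `ℝ²` is spherically symmetric and (weakly) decreasing. -/
def IsSymmDecreasing (h : EuclideanSpace ℝ (Fin 2) → ℝ) : Prop :=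
  ∃ φ : ℝ → ℝ, (∀ x, h x = φ ‖x‖) ∧ AntitoneOn φ (Set.Ici 0)

/-- A function on `ℝ²` is spherically symmetric and (weakly) increasing. -/
def IsSymmIncreasing (h : EuclideanSpace ℝ (Fin 2) → ℝ) : Prop :=
  ∃ φ : ℝ → ℝ, (∀ x, h x = φ ‖x‖) ∧ MonotoneOn φ (Set.Ici 0)

/-- `fs` is the symmetric-decreasing rearrangement of `f`: a nonnegative
measurable radially symmetric nonincreasing function equimeasurable with `f`. -/
def IsSymmDecrRearrangement (f fs : EuclideanSpace ℝ (Fin 2) → ℝ) : Prop :=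
  (∀ x, 0 ≤ fs x) ∧ Measurable fs ∧ IsSymmDecreasing fs ∧
    ∀ t > (0 : ℝ), volume {x | t < f x} = volume {x | t < fs x}

open scoped ENNReal

namespace RieszRearrangement

/-- A set in the plane which contains, with every point, all points of smaller or equal norm. -/
def IsRadialLower (S : Set ℂ) : Prop :=
  ∀ x ∈ S, ∀ y, ‖y‖ ≤ ‖x‖ → y ∈ S

/-- The properties of the reflection across a line missing the origin that matter for
polarization. -/
structure IsPolarizing (σ : ℂ → ℂ) : Prop where
  dist_map : ∀ x y, dist (σ x) (σ y) = dist x y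
  invol : ∀ x, σ (σ x) = x
  preserving : MeasurePreserving σ
  fixed : ∀ x, ‖σ x‖ = ‖x‖ → σ x = x
  dist_le : ∀ x y, ‖x‖ < ‖σ x‖ → ‖y‖ < ‖σ y‖ → dist x y ≤ dist x (σ y)

/-- The reflection across the line `{x | Re (x * conj u) = s}`, for `‖u‖ = 1`. -/
def lineReflection (s : ℝ) (u x : ℂ) : ℂ :=
  2 * s * u - (starRingEnd ℂ) x * u ^ 2

lemma sq_norm_lineReflection {s : ℝ} {u : ℂ} (hu : u.re ^ 2 + u.im ^ 2 = 1) (x : ℂ) :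
    ‖lineReflection s u x‖ ^ 2 = ‖x‖ ^ 2 + 4 * s * (s - (x.re * u.re + x.im * u.im)) := by
  simp only [Complex.sq_norm, Complex.normSq_apply, lineReflection, Complex.sub_re, Complex.sub_im,
    Complex.mul_re, Complex.mul_im, Complex.conj_re, Complex.conj_im, Complex.ofReal_re,
    Complex.ofReal_im, pow_two u, Complex.re_ofNat, Complex.im_ofNat]
  linear_combination ((x.re ^ 2 + x.im ^ 2) * (u.re ^ 2 + u.im ^ 2 + 1) + 4 * s ^ 2
    - 4 * s * (x.re * u.re + x.im * u.im)) * hu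

lemma sq_dist_lineReflection {s : ℝ} {u : ℂ} (hu : u.re ^ 2 + u.im ^ 2 = 1) (x y : ℂ) :
    dist x (lineReflection s u y) ^ 2 = dist x y ^ 2 +
      4 * (s - (x.re * u.re + x.im * u.im)) * (s - (y.re * u.re + y.im * u.im)) := by
  simp only [dist_eq_norm, Complex.sq_norm, Complex.normSq_apply, lineReflection, Complex.sub_re,
    Complex.sub_im, Complex.mul_re, Complex.mul_im, Complex.conj_re, Complex.conj_im,
    Complex.ofReal_re, Complex.ofReal_im, pow_two u, Complex.re_ofNat, Complex.im_ofNat]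
  linear_combination ((y.re ^ 2 + y.im ^ 2) * (u.re ^ 2 + u.im ^ 2 + 1) + 4 * s ^ 2
    - 4 * s * (y.re * u.re + y.im * u.im) - 2 * (x.re * y.re + x.im * y.im)) * hu

lemma isPolarizing_lineReflection {s : ℝ} (hs : 0 < s) {u : ℂ} (hu : ‖u‖ = 1) :
    IsPolarizing (lineReflection s u) := by
  have hu2 : u.re ^ 2 + u.im ^ 2 = 1 := by
    have := Complex.sq_norm u
    rw [hu, Complex.normSq_apply] at this
    linarith
  have huu : u * (starRingEnd ℂ) u = 1 := by
    rw [Complex.mul_conj, Complex.normSq_eq_norm_sq, hu]; simp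
  have hmp : MeasurePreserving (lineReflection s u) := by
    let c : Circle := ⟨-u ^ 2, by simp [Submonoid.unitSphere, hu]⟩
    let e : ℂ ≃ₗᵢ[ℝ] ℂ := Complex.conjLIE.trans (rotation c)
    have h1 : MeasurePreserving (fun x => 2 * s * u + e x) :=
      (measurePreserving_add_left volume (2 * s * u)).comp e.measurePreserving
    convert h1 using 2 with x
    change 2 * s * u - (starRingEnd ℂ) x * u ^ 2 = 2 * s * u + -u ^ 2 * (starRingEnd ℂ) x
    ring
  have hside : ∀ x, ‖x‖ < ‖lineReflection s u x‖ → 0 < s - (x.re * u.re + x.im * u.im) := by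
    intro x hx
    have h1 : ‖x‖ ^ 2 < ‖lineReflection s u x‖ ^ 2 := by gcongr
    rw [sq_norm_lineReflection hu2] at h1
    have : 0 < (4 * s) * (s - (x.re * u.re + x.im * u.im)) := by linarith
    exact pos_of_mul_pos_right this (by positivity)
  refine ⟨fun x y => ?_, fun x => ?_, hmp, fun x hx => ?_, fun x y hx hy => ?_⟩
  · have : lineReflection s u x - lineReflection s u y = (starRingEnd ℂ) (y - x) * u ^ 2 := by
      simp only [lineReflection, map_sub]; ring
    rw [dist_eq_norm, this, norm_mul, norm_pow, hu, RCLike.norm_conj, dist_eq_norm, norm_sub_rev]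
    simp
  · simp only [lineReflection, map_sub, map_mul, map_pow, Complex.conj_conj, Complex.conj_ofReal,
      map_ofNat]
    linear_combination (-2 * s * u + x * (u * (starRingEnd ℂ) u + 1)) * huu
  · have h1 := sq_norm_lineReflection (s := s) hu2 x
    rw [hx] at h1
    have h2 : s - (x.re * u.re + x.im * u.im) = 0 := by
      have : (4 * s) * (s - (x.re * u.re + x.im * u.im)) = 0 := by linarith
      exact (mul_eq_zero.1 this).resolve_left (by positivity)
    have h3 := sq_dist_lineReflection (s := s) hu2 x x
    rw [h2, dist_self] at h3
    have h4 : dist x (lineReflection s u x) = 0 := by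
      apply pow_eq_zero_iff (two_ne_zero) |>.1
      rw [h3]; ring
    exact (dist_eq_zero.1 h4).symm
  · apply le_of_sq_le_sq _ dist_nonneg
    rw [sq_dist_lineReflection hu2]
    have := mul_pos (hside x hx) (hside y hy)
    linarith

lemma lintegral_le_of_add_comp_le {α : Type*} [MeasurableSpace α] {μ : Measure α} {σ : α → α}
    (hσ : MeasurePreserving σ μ μ) {f g : α → ℝ≥0∞} (hf : Measurable f) (hg : Measurable g)
    (h : ∀ x, f x + f (σ x) ≤ g x + g (σ x)) : ∫⁻ x, f x ∂μ ≤ ∫⁻ x, g x ∂μ := by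
  have h1 := lintegral_mono (μ := μ) h
  rw [lintegral_add_left hf, lintegral_add_left hg, hσ.lintegral_comp hf, hσ.lintegral_comp hg,
    ← two_mul, ← two_mul] at h1
  exact (ENNReal.mul_le_mul_iff_right two_ne_zero ENNReal.ofNat_ne_top).1 h1

/-- The two-point rearrangement of a set under `σ`. -/
def polarize (σ : ℂ → ℂ) (A : Set ℂ) : Set ℂ :=
  {x | (x ∈ A ∧ σ x ∈ A) ∨ ((x ∈ A ∨ σ x ∈ A) ∧ ‖x‖ < ‖σ x‖)}

lemma measurableSet_polarize {σ : ℂ → ℂ} (hσ : IsPolarizing σ) {A : Set ℂ}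
    (hA : MeasurableSet A) : MeasurableSet (polarize σ A) := by
  have hm := hσ.preserving.measurable
  have h1 : MeasurableSet {x | σ x ∈ A} := hm hA
  exact (hA.inter h1).union ((hA.union h1).inter (measurableSet_lt measurable_norm hm.norm))

lemma norm_le_of_mem_polarize {σ : ℂ → ℂ} {A : Set ℂ} {R : ℝ}
    (hA : ∀ x ∈ A, ‖x‖ ≤ R) : ∀ x ∈ polarize σ A, ‖x‖ ≤ R := by
  rintro x (⟨h, -⟩ | ⟨h | h, hlt⟩)
  · exact hA x h
  · exact hA x h
  · exact hlt.le.trans (hA _ h)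

lemma indicator_polarize_add {σ : ℂ → ℂ} (hσ : IsPolarizing σ) (A : Set ℂ) (x : ℂ) :
    (polarize σ A).indicator (1 : ℂ → ℝ≥0∞) x + (polarize σ A).indicator 1 (σ x)
      = A.indicator 1 x + A.indicator 1 (σ x) := by
  classical
  simp only [Set.indicator_apply, polarize, Set.mem_ofPred_eq, hσ.invol, Pi.one_apply]
  rcases lt_trichotomy ‖x‖ ‖σ x‖ with h | h | h
  · by_cases h1 : x ∈ A <;> by_cases h2 : σ x ∈ A <;> simp [h, h.le, h1, h2]
  · rw [hσ.fixed x h.symm]; simp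
  · by_cases h1 : x ∈ A <;> by_cases h2 : σ x ∈ A <;> simp [h, h.le, h1, h2]

lemma volume_polarize {σ : ℂ → ℂ} (hσ : IsPolarizing σ) {A : Set ℂ} (hA : MeasurableSet A) :
    volume (polarize σ A) = volume A := by
  have hP := measurableSet_polarize hσ hA
  have m1 : Measurable (A.indicator (1 : ℂ → ℝ≥0∞)) := measurable_one.indicator hA
  have m2 : Measurable ((polarize σ A).indicator (1 : ℂ → ℝ≥0∞)) := measurable_one.indicator hP
  rw [← lintegral_indicator_one hP, ← lintegral_indicator_one hA]
  exact le_antisymm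
    (lintegral_le_of_add_comp_le hσ.preserving m2 m1 fun x => (indicator_polarize_add hσ A x).le)
    (lintegral_le_of_add_comp_le hσ.preserving m1 m2 fun x => (indicator_polarize_add hσ A x).ge)

lemma volume_polarize_diff_add_le {σ : ℂ → ℂ} (hσ : IsPolarizing σ) {A S : Set ℂ}
    (hA : MeasurableSet A) (hS : MeasurableSet S) (hSr : IsRadialLower S) :
    volume (polarize σ A \ S) + volume {y | y ∈ S \ A ∧ σ y ∈ A \ S} ≤ volume (A \ S) := by
  classical
  have hP := (measurableSet_polarize hσ hA).diff hS
  have hQ := hA.diff hS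
  have hG : MeasurableSet {y | y ∈ S \ A ∧ σ y ∈ A \ S} :=
    (hS.diff hA).inter (hσ.preserving.measurable hQ)
  have m1 := (measurable_one (α := ℝ≥0∞)).indicator hP
  have m2 := (measurable_one (α := ℝ≥0∞)).indicator hG
  rw [← lintegral_indicator_one hP, ← lintegral_indicator_one hG, ← lintegral_indicator_one hQ,
    ← lintegral_add_left m1]
  refine lintegral_le_of_add_comp_le hσ.preserving (m1.add m2) (measurable_one.indicator hQ)
    fun x => ?_
  have hx : ‖σ x‖ ≤ ‖x‖ → x ∈ S → σ x ∈ S := fun h hxS => hSr x hxS _ h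
  have hx' : ‖x‖ ≤ ‖σ x‖ → σ x ∈ S → x ∈ S := fun h hxS => hSr _ hxS _ h
  simp only [Set.indicator_apply, polarize, Set.mem_ofPred_eq, hσ.invol, Pi.one_apply,
    Set.mem_sdiff]
  rcases lt_trichotomy ‖x‖ ‖σ x‖ with h | h | h
  · have := hx' h.le
    by_cases h1 : x ∈ A <;> by_cases h2 : σ x ∈ A <;> by_cases h3 : x ∈ S <;>
      by_cases h4 : σ x ∈ S <;> simp_all [h.not_gt]
  · rw [hσ.fixed x h.symm]
    by_cases h1 : x ∈ A <;> by_cases h3 : x ∈ S <;> simp_all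
  · have := hx h.le
    by_cases h1 : x ∈ A <;> by_cases h2 : σ x ∈ A <;> by_cases h3 : x ∈ S <;>
      by_cases h4 : σ x ∈ S <;> simp_all [h.not_gt]

/-- The interaction energy of two planar sets with respect to a kernel depending on distance. -/
def energy (k : ℝ → ℝ≥0∞) (A B : Set ℂ) : ℝ≥0∞ :=
  ∫⁻ p : ℂ × ℂ in A ×ˢ B, k (dist p.1 p.2)

lemma energy_polarize_le {k : ℝ → ℝ≥0∞} (hk : Monotone k) {σ : ℂ → ℂ} (hσ : IsPolarizing σ)
    {A B : Set ℂ} (hA : MeasurableSet A) (hB : MeasurableSet B) :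
    energy k (polarize σ A) (polarize σ B) ≤ energy k A B := by
  classical
  have hkm : Measurable fun p : ℂ × ℂ => k (dist p.1 p.2) := hk.measurable.comp measurable_dist
  have hPA := (measurableSet_polarize hσ hA).prod (measurableSet_polarize hσ hB)
  have hAB := hA.prod hB
  unfold energy
  rw [← lintegral_indicator hPA, ← lintegral_indicator hAB]
  set F := ((polarize σ A) ×ˢ (polarize σ B)).indicator fun p : ℂ × ℂ => k (dist p.1 p.2) with hF
  set F₀ := (A ×ˢ B).indicator fun p : ℂ × ℂ => k (dist p.1 p.2) with hF₀
  have mF : Measurable F := hkm.indicator hPA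
  have mF₀ : Measurable F₀ := hkm.indicator hAB
  have t₁ : MeasurePreserving (Prod.map σ (id : ℂ → ℂ)) (volume : Measure (ℂ × ℂ)) volume :=
    hσ.preserving.prod (MeasurePreserving.id _)
  have t₂ : MeasurePreserving (Prod.map (id : ℂ → ℂ) σ) (volume : Measure (ℂ × ℂ)) volume :=
    (MeasurePreserving.id _).prod hσ.preserving
  have key : ∀ x y, F (x, y) + F (σ x, y) + (F (x, σ y) + F (σ x, σ y))
      ≤ F₀ (x, y) + F₀ (σ x, y) + (F₀ (x, σ y) + F₀ (σ x, σ y)) := by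
    intro x y
    have e₁ : dist (σ x) (σ y) = dist x y := hσ.dist_map x y
    have e₂ : dist (σ x) y = dist x (σ y) := by rw [← hσ.dist_map, hσ.invol]
    simp only [hF, hF₀, Set.indicator_apply, Set.mem_prod, polarize, Set.mem_ofPred_eq, hσ.invol,
      e₁, e₂]
    have same₁ : ‖x‖ < ‖σ x‖ → ‖y‖ < ‖σ y‖ → k (dist x y) ≤ k (dist x (σ y)) :=
      fun h h' => hk (hσ.dist_le x y h h')
    have same₂ : ‖σ x‖ < ‖x‖ → ‖σ y‖ < ‖y‖ → k (dist x y) ≤ k (dist x (σ y)) := fun h h' => by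
      have := hσ.dist_le (σ x) (σ y) (by rwa [hσ.invol]) (by rwa [hσ.invol])
      rw [hσ.invol, e₁, e₂] at this
      exact hk this
    have opp₁ : ‖x‖ < ‖σ x‖ → ‖σ y‖ < ‖y‖ → k (dist x (σ y)) ≤ k (dist x y) := fun h h' => by
      have := hσ.dist_le x (σ y) h (by rwa [hσ.invol])
      rw [hσ.invol] at this
      exact hk this
    have opp₂ : ‖σ x‖ < ‖x‖ → ‖y‖ < ‖σ y‖ → k (dist x (σ y)) ≤ k (dist x y) := fun h h' => by
      have := hσ.dist_le (σ x) y (by rwa [hσ.invol]) h'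
      rw [e₁, e₂] at this
      exact hk this
    generalize hα : k (dist x y) = α at *
    generalize hβ : k (dist x (σ y)) = β at *
    rcases lt_trichotomy ‖x‖ ‖σ x‖ with h | h | h
    · rcases lt_trichotomy ‖y‖ ‖σ y‖ with h' | h' | h'
      · have := same₁ h h'
        by_cases a : x ∈ A <;> by_cases a' : σ x ∈ A <;> by_cases b : y ∈ B <;>
          by_cases b' : σ y ∈ B <;> simp [a, a', b, b', h, h', h.not_gt, h'.not_gt, this,
            (add_comm α β).le]
      · have hy := hσ.fixed y h'.symm
        rw [hy] at hβ ⊢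
        obtain rfl : α = β := hα.symm.trans hβ
        by_cases a : x ∈ A <;> by_cases a' : σ x ∈ A <;> by_cases b : y ∈ B <;>
           simp [a, a', b, h, h.not_gt]
      · have := opp₁ h h'
        by_cases a : x ∈ A <;> by_cases a' : σ x ∈ A <;> by_cases b : y ∈ B <;>
          by_cases b' : σ y ∈ B <;> simp [a, a', b, b', h, h', h.not_gt, h'.not_gt, this,
            (add_comm α β).le, (add_comm β α).le]
    · have hx := hσ.fixed x h.symm
      rw [hx] at e₂ ⊢
      obtain rfl : α = β := by rw [← hα, ← hβ, e₂]
      rcases lt_trichotomy ‖y‖ ‖σ y‖ with h' | h' | h'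
      · by_cases a : x ∈ A <;> by_cases b : y ∈ B <;> by_cases b' : σ y ∈ B <;>
           simp [a, b, b', h', h'.not_gt]
      · rw [hσ.fixed y h'.symm]
        simp
      · by_cases a : x ∈ A <;> by_cases b : y ∈ B <;> by_cases b' : σ y ∈ B <;>
           simp [a, b, b', h', h'.not_gt]
    · rcases lt_trichotomy ‖y‖ ‖σ y‖ with h' | h' | h'
      · have := opp₂ h h'
        by_cases a : x ∈ A <;> by_cases a' : σ x ∈ A <;> by_cases b : y ∈ B <;>
          by_cases b' : σ y ∈ B <;> simp [a, a', b, b', h, h', h.not_gt, h'.not_gt, this,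
            (add_comm α β).le, (add_comm β α).le]
      · have hy := hσ.fixed y h'.symm
        rw [hy] at hβ ⊢
        obtain rfl : α = β := hα.symm.trans hβ
        by_cases a : x ∈ A <;> by_cases a' : σ x ∈ A <;> by_cases b : y ∈ B <;>
           simp [a, a', b, h, h.not_gt]
      · have := same₂ h h'
        by_cases a : x ∈ A <;> by_cases a' : σ x ∈ A <;> by_cases b : y ∈ B <;>
          by_cases b' : σ y ∈ B <;> simp [a, a', b, b', h, h', h.not_gt, h'.not_gt, this,
            (add_comm β α).le]
  have step : ∫⁻ p, F p + F (Prod.map σ id p) ≤ ∫⁻ p, F₀ p + F₀ (Prod.map σ id p) :=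
    lintegral_le_of_add_comp_le t₂ (mF.add (mF.comp t₁.measurable))
      (mF₀.add (mF₀.comp t₁.measurable)) fun p => key p.1 p.2
  rw [lintegral_add_left mF, lintegral_add_left mF₀, t₁.lintegral_comp mF, t₁.lintegral_comp mF₀,
    ← two_mul, ← two_mul] at step
  exact (ENNReal.mul_le_mul_iff_right two_ne_zero ENNReal.ofNat_ne_top).1 step

lemma dist_exp_mul_I_le (a b : ℝ) :
    ‖Complex.exp (a * Complex.I) - Complex.exp (b * Complex.I)‖ ≤ |a - b| := by
  have h : Complex.exp (a * Complex.I) - Complex.exp (b * Complex.I)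
      = Complex.exp (b * Complex.I) * (Complex.exp (Complex.I * ((a - b : ℝ) : ℂ)) - 1) := by
    rw [mul_sub, ← Complex.exp_add]
    push_cast
    ring_nf
  rw [h, norm_mul, Complex.norm_exp_ofReal_mul_I, one_mul]
  exact Real.norm_exp_I_mul_ofReal_sub_one_le

/-- Parameters of the lines at distance at most `R` from the origin. -/
def lineParams (R : ℝ) : Set (ℝ × ℝ) := Set.Ioc 0 R ×ˢ Set.Ioc (-Real.pi) Real.pi

lemma measurableSet_lineParams (R : ℝ) : MeasurableSet (lineParams R) :=
  measurableSet_Ioc.prod measurableSet_Ioc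

lemma volume_lineParams_ne_top (R : ℝ) : volume (lineParams R) ≠ ∞ := by
  rw [lineParams, Measure.volume_eq_prod, Measure.prod_prod]
  exact ENNReal.mul_ne_top measure_Ioc_lt_top.ne measure_Ioc_lt_top.ne

/-- The reflection with parameters `ω`: `ω.1` is the distance of the line to the origin and
`ω.2` is the argument of its normal. -/
def paramReflection (ω : ℝ × ℝ) : ℂ → ℂ :=
  lineReflection ω.1 (Complex.exp (ω.2 * Complex.I))

lemma continuous_paramReflection : Continuous fun p : (ℝ × ℝ) × ℂ => paramReflection p.1 p.2 := by
  unfold paramReflection lineReflection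
  fun_prop

lemma isPolarizing_paramReflection {R : ℝ} {ω : ℝ × ℝ} (hω : ω ∈ lineParams R) :
    IsPolarizing (paramReflection ω) :=
  isPolarizing_lineReflection hω.1.1 (Complex.norm_exp_ofReal_mul_I _)

lemma lipschitzOnWith_paramReflection {R : NNReal} {y : ℂ} (hy : ‖y‖ ≤ R) :
    LipschitzOnWith (2 + 4 * R) (fun ω => paramReflection ω y) (lineParams R) := by
  refine LipschitzOnWith.of_dist_le_mul fun ω hω ω' hω' => ?_
  set e := Complex.exp (ω.2 * Complex.I) with he
  set e' := Complex.exp (ω'.2 * Complex.I) with he'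
  have ne : ‖e‖ = 1 := Complex.norm_exp_ofReal_mul_I _
  have ne' : ‖e'‖ = 1 := Complex.norm_exp_ofReal_mul_I _
  have h0 : paramReflection ω y - paramReflection ω' y = 2 * ((ω.1 - ω'.1 : ℝ) : ℂ) * e
      + 2 * (ω'.1 : ℂ) * (e - e') - (starRingEnd ℂ) y * ((e + e') * (e - e')) := by
    simp only [paramReflection, lineReflection, ← he, ← he']
    push_cast
    ring
  have d1 : |ω.1 - ω'.1| ≤ dist ω ω' := le_max_left _ _
  have d2 : ‖e - e'‖ ≤ dist ω ω' := (dist_exp_mul_I_le _ _).trans (le_max_right _ _)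
  have hs : ‖(ω'.1 : ℂ)‖ ≤ R := by
    rw [Complex.norm_real, Real.norm_eq_abs, abs_of_pos hω'.1.1]
    exact hω'.1.2
  have hR : (0 : ℝ) ≤ R := R.2
  rw [dist_eq_norm, h0]
  calc _ ≤ ‖2 * ((ω.1 - ω'.1 : ℝ) : ℂ) * e‖ + ‖2 * (ω'.1 : ℂ) * (e - e')‖
        + ‖(starRingEnd ℂ) y * ((e + e') * (e - e'))‖ :=
        (norm_sub_le _ _).trans (add_le_add_left (norm_add_le _ _) _)
    _ = 2 * |ω.1 - ω'.1| + 2 * ‖(ω'.1 : ℂ)‖ * ‖e - e'‖ + ‖y‖ * (‖e + e'‖ * ‖e - e'‖) := by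
        simp only [norm_mul, ne, Complex.norm_ofNat, Complex.norm_real, Real.norm_eq_abs,
          RCLike.norm_conj, mul_one]
    _ ≤ 2 * dist ω ω' + 2 * R * dist ω ω' + R * (2 * dist ω ω') := by
        have : ‖e + e'‖ ≤ 2 := (norm_add_le _ _).trans (by rw [ne, ne']; norm_num)
        gcongr
    _ = _ := by push_cast; ring

lemma exists_paramReflection_eq {R : ℝ} {x y : ℂ} (hxy : ‖y‖ < ‖x‖) (hx : ‖x‖ ≤ R) :
    ∃ ω ∈ lineParams R, paramReflection ω y = x := by
  have hne : x - y ≠ 0 := sub_ne_zero.2 fun h => by rw [h] at hxy; exact lt_irrefl _ hxy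
  have hd : 0 < ‖x - y‖ := norm_pos_iff.2 hne
  have hdiff : ‖x‖ - ‖y‖ ≤ ‖x - y‖ := norm_sub_norm_le x y
  have hy := norm_nonneg y
  refine ⟨((‖x‖ ^ 2 - ‖y‖ ^ 2) / (2 * ‖x - y‖), (x - y).arg),
    ⟨⟨div_pos ?_ (by positivity), (div_le_iff₀ (by positivity)).2 ?_⟩,
      Complex.neg_pi_lt_arg _, Complex.arg_le_pi _⟩, ?_⟩
  · nlinarith
  · nlinarith
  · have hu : Complex.exp ((x - y).arg * Complex.I) = (x - y) / ‖x - y‖ := by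
      rw [eq_div_iff (by exact_mod_cast hd.ne'), mul_comm]
      exact Complex.norm_mul_exp_arg_mul_I _
    have hdC : (‖x - y‖ : ℂ) ≠ 0 := by exact_mod_cast hd.ne'
    have ex : ((‖x‖ : ℂ)) ^ 2 = x * (starRingEnd ℂ) x := (Complex.mul_conj' x).symm
    have ey : ((‖y‖ : ℂ)) ^ 2 = y * (starRingEnd ℂ) y := (Complex.mul_conj' y).symm
    have exy : ((‖x - y‖ : ℂ)) ^ 2 = (x - y) * (starRingEnd ℂ) (x - y) :=
      (Complex.mul_conj' _).symm
    rw [map_sub] at exy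
    simp only [paramReflection, lineReflection, hu]
    push_cast
    rw [ex, ey]
    field_simp
    rw [exy]
    ring

lemma volume_le_volume_paramReflection {R : NNReal} {y : ℂ} (hy : ‖y‖ ≤ R) {Q : Set ℂ}
    (hQ : ∀ x ∈ Q, ‖y‖ < ‖x‖ ∧ ‖x‖ ≤ R) :
    volume Q ≤ ((2 + 4 * R : NNReal) : ℝ≥0∞) ^ (2 : ℝ) *
      volume {ω ∈ lineParams R | paramReflection ω y ∈ Q} := by
  set e := Complex.measurableEquivRealProd
  have hsub : e '' Q ⊆
      (fun ω => e (paramReflection ω y)) '' {ω ∈ lineParams R | paramReflection ω y ∈ Q} := by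
    rintro _ ⟨x, hx, rfl⟩
    obtain ⟨ω, hω, rfl⟩ := exists_paramReflection_eq (hQ x hx).1 (hQ x hx).2
    exact ⟨ω, ⟨hω, hx⟩, rfl⟩
  have hlip : LipschitzOnWith (2 + 4 * R) (fun ω => e (paramReflection ω y))
      {ω ∈ lineParams R | paramReflection ω y ∈ Q} := by
    have he : LipschitzWith 1 e := LipschitzWith.of_dist_le_mul fun a b => by
      rw [NNReal.coe_one, one_mul, dist_eq_norm a b]
      exact max_le (by simpa [e, Real.dist_eq] using Complex.abs_re_le_norm (a - b))
        (by simpa [e, Real.dist_eq] using Complex.abs_im_le_norm (a - b))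
    simpa [Function.comp_def] using he.comp_lipschitzOnWith
      ((lipschitzOnWith_paramReflection hy).mono fun ω h => h.1)
  calc volume Q = volume (e '' Q) := by
        rw [MeasurableEquiv.image_eq_preimage_symm]
        exact (Complex.volume_preserving_equiv_real_prod.symm.measure_preimage_equiv Q).symm
    _ ≤ _ := measure_mono hsub
    _ ≤ _ := by
        rw [← hausdorffMeasure_prod_real]
        exact hlip.hausdorffMeasure_image_le zero_le_two

lemma volume_mul_volume_le {R : NNReal} {P Q : Set ℂ} (hP : MeasurableSet P)
    (hQ : MeasurableSet Q) (hQR : ∀ x ∈ Q, ‖x‖ ≤ R) (hPQ : ∀ y ∈ P, ∀ x ∈ Q, ‖y‖ < ‖x‖)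
    {m : ℝ≥0∞} (hm : ∀ ω ∈ lineParams R, volume {y | y ∈ P ∧ paramReflection ω y ∈ Q} ≤ m) :
    volume P * volume Q ≤
      ((2 + 4 * R : NNReal) : ℝ≥0∞) ^ (2 : ℝ) * volume (lineParams R) * m := by
  rcases Q.eq_empty_or_nonempty with rfl | ⟨x₀, hx₀⟩
  · simp
  set K := ((2 + 4 * R : NNReal) : ℝ≥0∞) ^ (2 : ℝ)
  let D : Set ((ℝ × ℝ) × ℂ) :=
    {p | p.1 ∈ lineParams R ∧ p.2 ∈ P ∧ paramReflection p.1 p.2 ∈ Q}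
  have hD : MeasurableSet D :=
    (measurable_fst (measurableSet_lineParams R)).inter
      ((measurable_snd hP).inter (continuous_paramReflection.measurable hQ))
  have h1 : volume P * volume Q ≤ K * (volume.prod volume) D := by
    rw [Measure.prod_apply_symm hD, mul_comm, ← setLIntegral_const, ← lintegral_const_mul _
      (measurable_measure_prodMk_right hD), ← lintegral_indicator hP]
    refine lintegral_mono fun y => ?_
    by_cases hy : y ∈ P
    · rw [Set.indicator_of_mem hy]
      convert volume_le_volume_paramReflection (y := y)
        ((hPQ y hy x₀ hx₀).le.trans (hQR x₀ hx₀)) fun x hx => ⟨hPQ y hy x hx, hQR x hx⟩ using 3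
      ext ω
      simp [D, hy]
    · simp [Set.indicator_of_notMem hy]
  have h2 : (volume.prod volume) D ≤ volume (lineParams R) * m := by
    rw [Measure.prod_apply hD, mul_comm, ← setLIntegral_const,
      ← lintegral_indicator (measurableSet_lineParams R)]
    refine lintegral_mono fun ω => ?_
    by_cases hω : ω ∈ lineParams R
    · rw [Set.indicator_of_mem hω]
      refine (measure_mono ?_).trans (hm ω hω)
      exact fun y hy => hy.2
    · have : Prod.mk ω ⁻¹' D = ∅ := by ext y; simp [D, hω]
      simp [this]
  calc _ ≤ _ := h1
    _ ≤ K * (volume (lineParams R) * m) := by gcongr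
    _ = _ := (mul_assoc _ _ _).symm

lemma volume_diff_le_volume_diff {A S : Set ℂ} (hA : MeasurableSet A) (hS : MeasurableSet S)
    (hAS : volume A ≤ volume S) (hSfin : volume S ≠ ∞) :
    volume (A \ S) ≤ volume (S \ A) := by
  rw [← measure_inter_add_sdiff A hS, ← measure_inter_add_sdiff S hA, Set.inter_comm S A] at hAS
  exact (ENNReal.add_le_add_iff_left (measure_ne_top_of_subset Set.inter_subset_right hSfin)).1 hAS

lemma sq_volume_diff_le {R : NNReal} {A S : Set ℂ} (hA : MeasurableSet A) (hS : MeasurableSet S)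
    (hAR : ∀ x ∈ A, ‖x‖ ≤ R) (hSr : IsRadialLower S) (hAS : volume A ≤ volume S)
    (hSfin : volume S ≠ ∞) {m : ℝ≥0∞}
    (hm : ∀ ω ∈ lineParams R, volume {y | y ∈ S \ A ∧ paramReflection ω y ∈ A \ S} ≤ m) :
    volume (A \ S) ^ 2 ≤
      ((2 + 4 * R : NNReal) : ℝ≥0∞) ^ (2 : ℝ) * volume (lineParams R) * m := by
  refine le_trans ?_ (volume_mul_volume_le (hS.diff hA) (hA.diff hS) (fun x hx => hAR x hx.1)
    (fun y hy x hx => ?_) hm)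
  · rw [pow_two]
    exact mul_le_mul' (volume_diff_le_volume_diff hA hS hAS hSfin) le_rfl
  · by_contra! h
    exact hx.2 (hSr y hy.1 x h)

lemma exists_energy_le_volume_diff_le {k : ℝ → ℝ≥0∞} (hk : Monotone k) {R : NNReal}
    {A B S T : Set ℂ} (hA : MeasurableSet A) (hB : MeasurableSet B) (hS : MeasurableSet S)
    (hT : MeasurableSet T) (hAR : ∀ x ∈ A, ‖x‖ ≤ R) (hBR : ∀ x ∈ B, ‖x‖ ≤ R)
    (hSr : IsRadialLower S) (hTr : IsRadialLower T) (hAS : volume A ≤ volume S)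
    (hBT : volume B ≤ volume T) (hSfin : volume S ≠ ∞) (hTfin : volume T ≠ ∞)
    {ε : ℝ≥0∞} (hε : ε ≠ 0) :
    ∃ A' B', MeasurableSet A' ∧ MeasurableSet B' ∧ volume A' = volume A ∧ volume B' = volume B ∧
      energy k A' B' ≤ energy k A B ∧ volume (A' \ S) + volume (B' \ T) ≤ ε := by
  let Adm : Set (Set ℂ × Set ℂ) := {p | MeasurableSet p.1 ∧ MeasurableSet p.2 ∧
    volume p.1 = volume A ∧ volume p.2 = volume B ∧ energy k p.1 p.2 ≤ energy k A B ∧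
    (∀ x ∈ p.1, ‖x‖ ≤ R) ∧ ∀ x ∈ p.2, ‖x‖ ≤ R}
  let excess : Set ℂ × Set ℂ → ℝ≥0∞ := fun p => volume (p.1 \ S) + volume (p.2 \ T)
  by_contra! hcon
  have hlarge : ∀ p ∈ Adm, ε < excess p := fun p hp =>
    hcon p.1 p.2 hp.1 hp.2.1 hp.2.2.1 hp.2.2.2.1 hp.2.2.2.2.1
  have hAB : (A, B) ∈ Adm := ⟨hA, hB, rfl, rfl, le_rfl, hAR, hBR⟩
  set d := ⨅ p ∈ Adm, excess p with hd
  have hd_le : ∀ p ∈ Adm, d ≤ excess p := fun p hp => iInf₂_le p hp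
  have hd_top : d ≠ ∞ := by
    refine ne_top_of_le_ne_top ?_ (hd_le _ hAB)
    exact ENNReal.add_ne_top.2 ⟨measure_ne_top_of_subset Set.sdiff_subset
      (ne_top_of_le_ne_top hSfin hAS), measure_ne_top_of_subset Set.sdiff_subset
      (ne_top_of_le_ne_top hTfin hBT)⟩
  set C := ((2 + 4 * R : NNReal) : ℝ≥0∞) ^ (2 : ℝ) * volume (lineParams R)
  have hC : C ≠ ∞ := ENNReal.mul_ne_top
    (ENNReal.rpow_ne_top_of_nonneg zero_le_two ENNReal.coe_ne_top) (volume_lineParams_ne_top R)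
  obtain ⟨m, hm0, hm⟩ := ENNReal.exists_nnreal_pos_mul_lt (b := (ε / 2) ^ 2) hC
    (pow_ne_zero 2 (ENNReal.div_pos hε ENNReal.ofNat_ne_top).ne')
  obtain ⟨p, hp, hpd⟩ : ∃ p ∈ Adm, excess p < d + m := by
    have : d < d + m := ENNReal.lt_add_right hd_top (by exact_mod_cast hm0.ne')
    simpa only [hd, iInf_lt_iff, exists_prop] using this
  obtain ⟨mA, mB, vA, vB, hE, rA, rB⟩ := id hp
  have hgain : ∀ ω ∈ lineParams R,
      volume {y | y ∈ S \ p.1 ∧ paramReflection ω y ∈ p.1 \ S} +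
        volume {y | y ∈ T \ p.2 ∧ paramReflection ω y ∈ p.2 \ T} ≤ m := by
    intro ω hω
    have hσ := isPolarizing_paramReflection hω
    have hadm : (polarize (paramReflection ω) p.1, polarize (paramReflection ω) p.2) ∈ Adm :=
      ⟨measurableSet_polarize hσ mA, measurableSet_polarize hσ mB,
        (volume_polarize hσ mA).trans vA, (volume_polarize hσ mB).trans vB,
        (energy_polarize_le hk hσ mA mB).trans hE, norm_le_of_mem_polarize rA,
        norm_le_of_mem_polarize rB⟩
    have h1 := add_le_add (volume_polarize_diff_add_le hσ mA hS hSr)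
      (volume_polarize_diff_add_le hσ mB hT hTr)
    rw [add_add_add_comm] at h1
    exact (ENNReal.add_le_add_iff_left hd_top).1
      (((add_le_add_left (hd_le _ hadm) _).trans h1).trans hpd.le)
  have h1 : volume (p.1 \ S) ^ 2 ≤ C * m := sq_volume_diff_le mA hS rA hSr (vA.trans_le hAS) hSfin
    fun ω hω => le_self_add.trans (hgain ω hω)
  have h2 : volume (p.2 \ T) ^ 2 ≤ C * m := sq_volume_diff_le mB hT rB hTr (vB.trans_le hBT) hTfin
    fun ω hω => le_add_self.trans (hgain ω hω)
  rw [mul_comm] at hm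
  have h3 := lt_of_pow_lt_pow_left' 2 (h1.trans_lt hm)
  have h4 := lt_of_pow_lt_pow_left' 2 (h2.trans_lt hm)
  have h5 := ENNReal.add_lt_add h3 h4
  rw [ENNReal.add_halves] at h5
  exact lt_asymm h5 (hlarge p hp)

lemma energy_le_energy_add {k : ℝ → ℝ≥0∞} {N : ℝ≥0∞} (hN : ∀ t, k t ≤ N) {S T : Set ℂ}
    (A B : Set ℂ) :
    energy k S T ≤ energy k A B + N * (volume (S \ A) * volume T + volume S * volume (T \ B)) := by
  have hsub : S ×ˢ T ⊆ A ×ˢ B ∪ ((S \ A) ×ˢ T ∪ S ×ˢ (T \ B)) := by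
    rintro ⟨x, y⟩ ⟨hx, hy⟩
    by_cases h1 : x ∈ A <;> by_cases h2 : y ∈ B <;> simp_all
  have hb : ∀ E : Set (ℂ × ℂ), ∫⁻ p in E, k (dist p.1 p.2) ≤ N * volume E := fun E => by
    rw [← setLIntegral_const]
    exact lintegral_mono fun p => hN _
  calc energy k S T ≤ ∫⁻ p in A ×ˢ B ∪ ((S \ A) ×ˢ T ∪ S ×ˢ (T \ B)), k (dist p.1 p.2) :=
        lintegral_mono_set hsub
    _ ≤ energy k A B + ((∫⁻ p in (S \ A) ×ˢ T, k (dist p.1 p.2))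
        + ∫⁻ p in S ×ˢ (T \ B), k (dist p.1 p.2)) :=
        (lintegral_union_le _ _ _).trans (add_le_add_right (lintegral_union_le _ _ _) _)
    _ ≤ energy k A B + (N * (volume (S \ A) * volume T) + N * (volume S * volume (T \ B))) := by
        gcongr
        · exact (hb _).trans_eq (by rw [Measure.volume_eq_prod, Measure.prod_prod])
        · exact (hb _).trans_eq (by rw [Measure.volume_eq_prod, Measure.prod_prod])
    _ = _ := by rw [mul_add]

lemma energy_mono_set (k : ℝ → ℝ≥0∞) {A A' B B' : Set ℂ} (hA : A ⊆ A') (hB : B ⊆ B') :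
    energy k A B ≤ energy k A' B' :=
  lintegral_mono_set (Set.prod_mono hA hB)

lemma exists_volume_diff_closedBall_le {A : Set ℂ} (hA : MeasurableSet A) (hfin : volume A ≠ ∞)
    {ε : ℝ≥0∞} (hε : ε ≠ 0) :
    ∃ n : ℕ, ∀ m ≥ n, volume (A \ Metric.closedBall 0 (m : ℝ)) ≤ ε := by
  have h := tendsto_measure_iInter_atTop (μ := volume)
    (s := fun n : ℕ => A \ Metric.closedBall 0 (n : ℝ))
    (fun n => (hA.diff Metric.isClosed_closedBall.measurableSet).nullMeasurableSet)
    (fun m n hmn => Set.sdiff_subset_sdiff_right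
      (Metric.closedBall_subset_closedBall (by exact_mod_cast hmn)))
    ⟨0, measure_ne_top_of_subset Set.sdiff_subset hfin⟩
  have h0 : ⋂ n : ℕ, A \ Metric.closedBall (0 : ℂ) (n : ℝ) = ∅ := by
    rw [← Set.sdiff_iUnion, Metric.iUnion_closedBall_nat, Set.sdiff_univ]
  rw [h0, measure_empty] at h
  exact Filter.eventually_atTop.1 ((h.eventually_lt_const hε.bot_lt).mono fun _ h => h.le)

lemma volume_diff_le_of_volume_diff_le {A' S : Set ℂ} {r : ℝ≥0∞} (hA' : MeasurableSet A')
    (hS : MeasurableSet S) (hSfin : volume S ≠ ∞) (hvol : volume S ≤ volume A' + r) :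
    volume (S \ A') ≤ volume (A' \ S) + r := by
  rw [← measure_inter_add_sdiff S hA', ← measure_inter_add_sdiff A' hS, Set.inter_comm A' S,
    add_assoc] at hvol
  exact (ENNReal.add_le_add_iff_left (measure_ne_top_of_subset Set.inter_subset_left hSfin)).1 hvol

lemma energy_le_of_bounded {k : ℝ → ℝ≥0∞} (hk : Monotone k) {N : ℝ≥0∞} (hN : ∀ t, k t ≤ N)
    (hNfin : N ≠ ∞) {A B S T : Set ℂ} (hA : MeasurableSet A) (hB : MeasurableSet B)
    (hS : MeasurableSet S) (hT : MeasurableSet T) (hSr : IsRadialLower S) (hTr : IsRadialLower T)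
    (hAS : volume A = volume S) (hBT : volume B = volume T) (hSfin : volume S ≠ ∞)
    (hTfin : volume T ≠ ∞) : energy k S T ≤ energy k A B := by
  have key : ∀ ε : ℝ≥0∞, ε ≠ 0 →
      energy k S T ≤ energy k A B + ε * (N * (2 * volume T + volume S * 2)) := by
    intro ε hε
    obtain ⟨n₁, hn₁⟩ := exists_volume_diff_closedBall_le hA (hAS ▸ hSfin) hε
    obtain ⟨n₂, hn₂⟩ := exists_volume_diff_closedBall_le hB (hBT ▸ hTfin) hε
    set n := max n₁ n₂
    set D := Metric.closedBall (0 : ℂ) (n : ℝ) with hD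
    have mD : MeasurableSet D := Metric.isClosed_closedBall.measurableSet
    have hDn : ∀ E : Set ℂ, ∀ x ∈ E ∩ D, ‖x‖ ≤ (n : NNReal) := fun E x hx => by
      simpa [hD] using hx.2
    obtain ⟨A', B', mA, mB, vA, vB, hE, hex⟩ := exists_energy_le_volume_diff_le hk
      (hA.inter mD) (hB.inter mD) hS hT (hDn A) (hDn B) hSr hTr
      ((measure_mono Set.inter_subset_left).trans hAS.le)
      ((measure_mono Set.inter_subset_left).trans hBT.le) hSfin hTfin hε
    have dS : volume (S \ A') ≤ ε * 2 := by
      rw [mul_two]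
      refine (volume_diff_le_of_volume_diff_le (r := ε) mA hS hSfin ?_).trans
        (add_le_add_left (le_self_add.trans hex) _)
      rw [← hAS, vA, ← measure_inter_add_sdiff A mD]
      exact add_le_add_right (hn₁ n (le_max_left _ _)) _
    have dT : volume (T \ B') ≤ ε * 2 := by
      rw [mul_two]
      refine (volume_diff_le_of_volume_diff_le (r := ε) mB hT hTfin ?_).trans
        (add_le_add_left (le_add_self.trans hex) _)
      rw [← hBT, vB, ← measure_inter_add_sdiff B mD]
      exact add_le_add_right (hn₂ n (le_max_right _ _)) _
    calc energy k S T
        ≤ energy k A' B' + N * (volume (S \ A') * volume T + volume S * volume (T \ B')) :=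
          energy_le_energy_add hN A' B'
      _ ≤ energy k A B + N * (ε * 2 * volume T + volume S * (ε * 2)) := by
          gcongr
          exact hE.trans (energy_mono_set k Set.inter_subset_left Set.inter_subset_left)
      _ = _ := by ring
  have hC : N * (2 * volume T + volume S * 2) ≠ ∞ := ENNReal.mul_ne_top hNfin
    (ENNReal.add_ne_top.2 ⟨ENNReal.mul_ne_top ENNReal.ofNat_ne_top hTfin,
      ENNReal.mul_ne_top hSfin ENNReal.ofNat_ne_top⟩)
  refine ENNReal.le_of_forall_pos_le_add fun δ hδ _ => ?_
  obtain ⟨ε, hε, hεδ⟩ := ENNReal.exists_nnreal_pos_mul_lt (b := (δ : ℝ≥0∞)) hC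
    (by exact_mod_cast hδ.ne')
  exact (key ε (by exact_mod_cast hε.ne')).trans (add_le_add_right hεδ.le _)

/-- Riesz's inequality for sets and an increasing kernel: among pairs of planar sets of given
areas, concentric discs minimize the interaction energy. -/
lemma energy_le_energy {k : ℝ → ℝ≥0∞} (hk : Monotone k) {A B S T : Set ℂ} (hA : MeasurableSet A)
    (hB : MeasurableSet B) (hS : MeasurableSet S) (hT : MeasurableSet T) (hSr : IsRadialLower S)
    (hTr : IsRadialLower T) (hAS : volume A = volume S) (hBT : volume B = volume T)
    (hSfin : volume S ≠ ∞) (hTfin : volume T ≠ ∞) : energy k S T ≤ energy k A B := by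
  have hmono : ∀ n : ℕ, Monotone fun t => min (k t) n := fun n => hk.min monotone_const
  have hsup : ∀ t, k t = ⨆ n : ℕ, min (k t) n := fun t => by
    rw [← inf_iSup_eq, ENNReal.iSup_natCast, inf_top_eq]
  have h : energy k S T = ⨆ n : ℕ, energy (fun t => min (k t) n) S T := by
    have hm : ∀ n : ℕ, Measurable fun p : ℂ × ℂ => min (k (dist p.1 p.2)) (n : ℝ≥0∞) :=
      fun n => (hmono n).measurable.comp measurable_dist
    change _ = ⨆ n : ℕ, ∫⁻ p : ℂ × ℂ in S ×ˢ T, min (k (dist p.1 p.2)) n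
    rw [← lintegral_iSup hm (fun m n hmn p => min_le_min_left _ (by exact_mod_cast hmn))]
    exact lintegral_congr fun p => hsup _
  rw [h]
  refine iSup_le fun n => ?_
  calc _ ≤ energy (fun t => min (k t) n) A B :=
        energy_le_of_bounded (hmono n) (fun t => min_le_right _ _) (ENNReal.natCast_ne_top n) hA hB
          hS hT hSr hTr hAS hBT hSfin hTfin
    _ ≤ energy k A B := lintegral_mono fun p => min_le_left _ _

lemma lintegral_ofReal_mul {α : Type*} [MeasurableSpace α] (μ : Measure α) {f : α → ℝ}
    (hf : Measurable f) (hf0 : ∀ x, 0 ≤ f x) {H : α → ℝ≥0∞} (hH : Measurable H) :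
    ∫⁻ x, ENNReal.ofReal (f x) * H x ∂μ =
      ∫⁻ t in Set.Ioi (0 : ℝ), ∫⁻ x in {x | t < f x}, H x ∂μ := by
  have h := lintegral_eq_lintegral_meas_lt (μ.withDensity H) (Filter.Eventually.of_forall hf0)
    hf.aemeasurable
  rw [lintegral_withDensity_eq_lintegral_mul _ hH hf.ennreal_ofReal] at h
  simp_rw [withDensity_apply _ (measurableSet_lt measurable_const hf)] at h
  rw [← h]
  simp only [Pi.mul_apply, mul_comm]

lemma lintegral_ofReal_mul_eq_lintegral_energy {k : ℝ → ℝ≥0∞} (hk : Monotone k) {f g : ℂ → ℝ}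
    (hf : Measurable f) (hg : Measurable g) (hf0 : ∀ x, 0 ≤ f x) (hg0 : ∀ x, 0 ≤ g x) :
    ∫⁻ p : ℂ × ℂ, ENNReal.ofReal (f p.1) * (ENNReal.ofReal (g p.2) * k (dist p.1 p.2)) =
      ∫⁻ t in Set.Ioi (0 : ℝ), ∫⁻ u in Set.Ioi (0 : ℝ), energy k {x | t < f x} {x | u < g x} := by
  have hkm : Measurable fun p : ℂ × ℂ => k (dist p.1 p.2) := hk.measurable.comp measurable_dist
  have hH : Measurable fun p : ℂ × ℂ => ENNReal.ofReal (g p.2) * k (dist p.1 p.2) :=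
    (hg.comp measurable_snd).ennreal_ofReal.mul hkm
  rw [lintegral_ofReal_mul volume (f := fun p : ℂ × ℂ => f p.1) (hf.comp measurable_fst)
    (fun p => hf0 p.1) hH]
  refine lintegral_congr fun t => ?_
  rw [lintegral_ofReal_mul _ (f := fun p : ℂ × ℂ => g p.2) (hg.comp measurable_snd)
    (fun p => hg0 p.2) hkm]
  refine lintegral_congr fun u => ?_
  have hgu : MeasurableSet {p : ℂ × ℂ | u < g p.2} :=
    measurableSet_lt measurable_const (hg.comp measurable_snd)
  rw [Measure.restrict_restrict hgu, Set.inter_comm]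
  rfl

lemma lintegral_rearrangement_le {k : ℝ → ℝ≥0∞} (hk : Monotone k) {f g fs gs : ℂ → ℝ}
    (hf : Measurable f) (hg : Measurable g) (hfs : Measurable fs) (hgs : Measurable gs)
    (hf0 : ∀ x, 0 ≤ f x) (hg0 : ∀ x, 0 ≤ g x) (hfs0 : ∀ x, 0 ≤ fs x) (hgs0 : ∀ x, 0 ≤ gs x)
    (hfr : ∀ t, IsRadialLower {x | t < fs x}) (hgr : ∀ t, IsRadialLower {x | t < gs x})
    (hffs : ∀ t > 0, volume {x | t < f x} = volume {x | t < fs x})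
    (hggs : ∀ t > 0, volume {x | t < g x} = volume {x | t < gs x})
    (hfvan : ∀ t > 0, volume {x | t < f x} < ∞) (hgvan : ∀ t > 0, volume {x | t < g x} < ∞) :
    ∫⁻ p : ℂ × ℂ, ENNReal.ofReal (fs p.1) * (ENNReal.ofReal (gs p.2) * k (dist p.1 p.2)) ≤
      ∫⁻ p : ℂ × ℂ, ENNReal.ofReal (f p.1) * (ENNReal.ofReal (g p.2) * k (dist p.1 p.2)) := by
  rw [lintegral_ofReal_mul_eq_lintegral_energy hk hf hg hf0 hg0,
    lintegral_ofReal_mul_eq_lintegral_energy hk hfs hgs hfs0 hgs0]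
  refine setLIntegral_mono' measurableSet_Ioi fun t ht => ?_
  refine setLIntegral_mono' measurableSet_Ioi fun u hu => ?_
  exact energy_le_energy hk (measurableSet_lt measurable_const hf)
    (measurableSet_lt measurable_const hg) (measurableSet_lt measurable_const hfs)
    (measurableSet_lt measurable_const hgs) (hfr t) (hgr u) (hffs t ht) (hggs u hu)
    (hffs t ht ▸ (hfvan t ht).ne) (hggs u hu ▸ (hgvan u hu).ne)

lemma isRadialLower_of_isSymmDecreasing (e : ℂ ≃ₗᵢ[ℝ] EuclideanSpace ℝ (Fin 2))
    {h : EuclideanSpace ℝ (Fin 2) → ℝ} (hh : IsSymmDecreasing h) (t : ℝ) :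
    IsRadialLower {x | t < h (e x)} := by
  obtain ⟨φ, hφ, hanti⟩ := hh
  intro x hx y hyx
  simp only [Set.mem_ofPred_eq, hφ, e.norm_map] at hx ⊢
  exact hx.trans_le (hanti (norm_nonneg y) (norm_nonneg x) hyx)

lemma lintegral_lintegral_eq_complex (e : ℂ ≃ₗᵢ[ℝ] EuclideanSpace ℝ (Fin 2)) {k : ℝ → ℝ≥0∞}
    {f g v : EuclideanSpace ℝ (Fin 2) → ℝ} (hf : Measurable f) (hg : Measurable g)
    (hv : Measurable v) (hf0 : ∀ x, 0 ≤ f x) (hv0 : ∀ x, 0 ≤ v x)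
    (hvk : ∀ x, ENNReal.ofReal (v x) = k ‖x‖) :
    ∫⁻ x, ∫⁻ y, ENNReal.ofReal (f x * v (x - y) * g y) =
      ∫⁻ p : ℂ × ℂ, ENNReal.ofReal (f (e p.1)) *
        (ENNReal.ofReal (g (e p.2)) * k (dist p.1 p.2)) := by
  have hm : Measurable fun p : EuclideanSpace ℝ (Fin 2) × EuclideanSpace ℝ (Fin 2) =>
      ENNReal.ofReal (f p.1 * v (p.1 - p.2) * g p.2) := by fun_prop
  have hmp := e.measurePreserving.prod e.measurePreserving
  rw [← lintegral_prod _ hm.aemeasurable, ← hmp.lintegral_comp hm]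
  refine lintegral_congr fun p => ?_
  simp only [Prod.map_fst, Prod.map_snd]
  rw [ENNReal.ofReal_mul (mul_nonneg (hf0 _) (hv0 _)), ENNReal.ofReal_mul (hf0 _), hvk,
    ← map_sub, e.norm_map, dist_eq_norm, mul_assoc, mul_comm (k _)]

end RieszRearrangement

open RieszRearrangement

theorem riesz_type_rearrangement_increasing_kernel
    (f g fs gs v : EuclideanSpace ℝ (Fin 2) → ℝ)
    (hf : Measurable f) (hg : Measurable g) (hv : Measurable v)
    (hf0 : ∀ x, 0 ≤ f x) (hg0 : ∀ x, 0 ≤ g x) (hv0 : ∀ x, 0 ≤ v x)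
    (hfvan : ∀ t > (0 : ℝ), volume {x | t < f x} < ⊤)
    (hgvan : ∀ t > (0 : ℝ), volume {x | t < g x} < ⊤)
    (hfs : IsSymmDecrRearrangement f fs)
    (hgs : IsSymmDecrRearrangement g gs)
    (hvsym : IsSymmIncreasing v) :
    ∫⁻ x, ∫⁻ y, ENNReal.ofReal (fs x * v (x - y) * gs y)
      ≤ ∫⁻ x, ∫⁻ y, ENNReal.ofReal (f x * v (x - y) * g y) := by
  obtain ⟨hfs0, hfsm, hfsr, hfeq⟩ := hfs
  obtain ⟨hgs0, hgsm, hgsr, hgeq⟩ := hgs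
  obtain ⟨φ, hφ, hmono⟩ := hvsym
  let e : ℂ ≃ₗᵢ[ℝ] EuclideanSpace ℝ (Fin 2) := Complex.orthonormalBasisOneI.repr
  let k : ℝ → ℝ≥0∞ := fun t => ENNReal.ofReal (φ (max t 0))
  have hk : Monotone k := fun a b hab => ENNReal.ofReal_le_ofReal
    (hmono (le_max_right a 0) (le_max_right b 0) (max_le_max_right 0 hab))
  have hvk : ∀ x, ENNReal.ofReal (v x) = k ‖x‖ := fun x => by
    simp only [k, hφ, max_eq_left (norm_nonneg x)]
  have hvol : ∀ h : EuclideanSpace ℝ (Fin 2) → ℝ, Measurable h → ∀ t,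
      volume {x | t < h (e x)} = volume {x | t < h x} := fun h hh t =>
    e.measurePreserving.measure_preimage (measurableSet_lt measurable_const hh).nullMeasurableSet
  rw [lintegral_lintegral_eq_complex e hfsm hgsm hv hfs0 hv0 hvk,
    lintegral_lintegral_eq_complex e hf hg hv hf0 hv0 hvk]
  have he : Measurable e := e.continuous.measurable
  refine lintegral_rearrangement_le hk (hf.comp he) (hg.comp he) (hfsm.comp he) (hgsm.comp he)
    (fun x => hf0 _) (fun x => hg0 _) (fun x => hfs0 _) (fun x => hgs0 _)
    (isRadialLower_of_isSymmDecreasing e hfsr) (isRadialLower_of_isSymmDecreasing e hgsr)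
    (fun t ht => ?_) (fun t ht => ?_) (fun t ht => ?_) (fun t ht => ?_)
  · exact (hvol f hf t).trans ((hfeq t ht).trans (hvol fs hfsm t).symm)
  · exact (hvol g hg t).trans ((hgeq t ht).trans (hvol gs hgsm t).symm)
  · exact (hvol f hf t).trans_lt (hfvan t ht)
  · exact (hvol g hg t).trans_lt (hgvan t ht)
end
end

section
/- The energy functional E(u) = ∫|∇u|^2 dx + (γ/4π)∫∫ ln|x−y| |u(x)|^2 |u(y)|^2 dx dy is well defined (finite) for every u in X. -/
open MeasureTheory

lemma norm_le_integral_norm_deriv {E : Type*} [NormedAddCommGroup E] [NormedSpace ℝ E]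
    [CompleteSpace E] {f f' : ℝ → E} (hderiv : ∀ x, HasDerivAt f (f' x) x)
    (hf : Integrable f) (hf' : Integrable f') (x : ℝ) : ‖f x‖ ≤ ∫ s, ‖f' s‖ := by
  have hlim := tendsto_zero_of_hasDerivAt_of_integrableOn_Iic (a := x) (fun s _ => hderiv s)
    hf'.integrableOn hf.integrableOn
  have heq := integral_Iic_of_hasDerivAt_of_tendsto' (a := x) (fun s _ => hderiv s)
    hf'.integrableOn hlim
  rw [sub_zero] at heq
  rw [← heq]
  exact (norm_integral_le_integral_norm _).trans
    (setIntegral_le_integral hf'.norm (Filter.Eventually.of_forall fun _ => norm_nonneg _))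

/-- A planar function which is integrable together with its two partial derivatives is square
integrable (the Gagliardo–Nirenberg inequality in dimension two, without `C¹` regularity). -/
lemma integrable_sq_of_integrable_partialDeriv {f f₁ f₂ : ℝ × ℝ → ℝ}
    (h₁ : ∀ x y, HasDerivAt (fun s => f (s, y)) (f₁ (x, y)) x)
    (h₂ : ∀ x y, HasDerivAt (fun s => f (x, s)) (f₂ (x, y)) y)
    (hf : Integrable f) (hf₁ : Integrable f₁) (hf₂ : Integrable f₂) :
    Integrable (fun p => f p ^ 2) := by
  rw [Measure.volume_eq_prod] at *
  have hrow : ∀ᵐ y : ℝ, ∀ x, ‖f (x, y)‖ ≤ ∫ s, ‖f₁ (s, y)‖ := by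
    filter_upwards [hf.prod_left_ae, hf₁.prod_left_ae] with y hy hy'
    exact fun x => norm_le_integral_norm_deriv (fun s => h₁ s y) hy hy' x
  have hcol : ∀ᵐ x : ℝ, ∀ y, ‖f (x, y)‖ ≤ ∫ s, ‖f₂ (x, s)‖ := by
    filter_upwards [hf.prod_right_ae, hf₂.prod_right_ae] with x hx hx'
    exact fun y => norm_le_integral_norm_deriv (fun s => h₂ x s) hx hx' y
  refine (hf₂.integral_norm_prod_left.mul_prod hf₁.integral_norm_prod_right).mono'
    (hf.aestronglyMeasurable.pow 2) ?_
  filter_upwards [Measure.quasiMeasurePreserving_fst.ae hcol,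
    Measure.quasiMeasurePreserving_snd.ae hrow] with p hp hp'
  rw [norm_pow, sq]
  exact mul_le_mul (hp p.2) (hp' p.1) (norm_nonneg _) (integral_nonneg fun _ => norm_nonneg _)

/-- The `W^{1,1} ⊂ L²` embedding on the Euclidean plane, for everywhere differentiable functions. -/
lemma integrable_sq_of_integrable_fderiv {f : EuclideanSpace ℝ (Fin 2) → ℝ}
    (hd : Differentiable ℝ f) (hf : Integrable f) (hf' : Integrable (fderiv ℝ f)) :
    Integrable (fun x => f x ^ 2) := by
  let e : ℝ × ℝ ≃ᵐ EuclideanSpace ℝ (Fin 2) :=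
    MeasurableEquiv.finTwoArrow.symm.trans (MeasurableEquiv.toLp 2 (Fin 2 → ℝ))
  have he : MeasurePreserving e :=
    (volume_preserving_finTwoArrow ℝ).symm.trans (PiLp.volume_preserving_toLp (Fin 2))
  have he_apply (x y : ℝ) : e (x, y) =
      x • EuclideanSpace.single 0 (1 : ℝ) + y • EuclideanSpace.single 1 (1 : ℝ) := by
    ext i
    fin_cases i <;> simp [e, MeasurableEquiv.finTwoArrow]
  have he₁ (x y : ℝ) :
      HasDerivAt (fun s => e (s, y)) (EuclideanSpace.single 0 (1 : ℝ)) x := by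
    simp only [he_apply]
    simpa using ((hasDerivAt_id x).smul_const (EuclideanSpace.single (0 : Fin 2) (1 : ℝ))).add_const
      (y • EuclideanSpace.single (1 : Fin 2) (1 : ℝ))
  have he₂ (x y : ℝ) :
      HasDerivAt (fun s => e (x, s)) (EuclideanSpace.single 1 (1 : ℝ)) y := by
    simp only [he_apply]
    simpa using ((hasDerivAt_id y).smul_const (EuclideanSpace.single (1 : Fin 2) (1 : ℝ))).const_add
      (x • EuclideanSpace.single (0 : Fin 2) (1 : ℝ))
  have hpartial (v : EuclideanSpace ℝ (Fin 2)) :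
      Integrable (fun p : ℝ × ℝ => fderiv ℝ f (e p) v) :=
    (he.integrable_comp_emb e.measurableEmbedding).2 (hf'.apply_continuousLinearMap v)
  rw [← he.integrable_comp_emb e.measurableEmbedding]
  exact integrable_sq_of_integrable_partialDeriv (f := fun p => f (e p))
    (f₁ := fun p => fderiv ℝ f (e p) (EuclideanSpace.single 0 1))
    (f₂ := fun p => fderiv ℝ f (e p) (EuclideanSpace.single 1 1))
    (fun x y => (hd (e (x, y))).hasFDerivAt.comp_hasDerivAt x (he₁ x y))
    (fun x y => (hd (e (x, y))).hasFDerivAt.comp_hasDerivAt y (he₂ x y))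
    ((he.integrable_comp_emb e.measurableEmbedding).2 hf) (hpartial _) (hpartial _)

/-- The `H¹ ⊂ L⁴` embedding on the Euclidean plane, for everywhere differentiable functions. -/
lemma integrable_norm_sq_sq_of_integrable_fderiv {F : Type*} [NormedAddCommGroup F]
    [InnerProductSpace ℝ F] [CompleteSpace F] {u : EuclideanSpace ℝ (Fin 2) → F}
    (hu : Differentiable ℝ u) (hL2 : Integrable (fun x => ‖u x‖ ^ 2))
    (hgrad : Integrable (fun x => ‖fderiv ℝ u x‖ ^ 2)) :
    Integrable (fun x => (‖u x‖ ^ 2) ^ 2) := by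
  have hderiv x := (hu x).hasFDerivAt.norm_sq
  refine integrable_sq_of_integrable_fderiv (fun x => (hderiv x).differentiableAt) hL2 ?_
  refine (hL2.add hgrad).mono' (measurable_fderiv ℝ _).aestronglyMeasurable
    (Filter.Eventually.of_forall fun x => ?_)
  rw [(hderiv x).fderiv]
  have hcomp : ‖innerSL ℝ (u x) ∘SL fderiv ℝ u x‖ ≤ ‖u x‖ * ‖fderiv ℝ u x‖ :=
    (ContinuousLinearMap.opNorm_comp_le _ _).trans_eq (by rw [innerSL_apply_norm])
  have hsmul : ‖2 • (innerSL ℝ (u x) ∘SL fderiv ℝ u x)‖ ≤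
      2 * ‖innerSL ℝ (u x) ∘SL fderiv ℝ u x‖ := by
    simpa using norm_nsmul_le (n := 2) (a := innerSL ℝ (u x) ∘SL fderiv ℝ u x)
  simp only [Pi.add_apply]
  nlinarith [sq_nonneg (‖u x‖ - ‖fderiv ℝ u x‖)]

/-- The singular part `1 / r` of the kernel, which dominates `|ln r|` on `(0, 1)`, is integrable
near the origin of the plane. -/
lemma integrable_indicator_inv_norm :
    Integrable (fun z : EuclideanSpace ℝ (Fin 2) =>
      (Set.Iio (1 : ℝ)).indicator (fun r => r⁻¹) ‖z‖) := by
  rw [integrable_fun_norm_addHaar volume (f := (Set.Iio (1 : ℝ)).indicator fun r => r⁻¹)]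
  have hone : IntegrableOn ((Set.Iio (1 : ℝ)).indicator fun _ => (1 : ℝ)) (Set.Ioi 0) := by
    rw [IntegrableOn, integrable_indicator_iff measurableSet_Iio, IntegrableOn,
      Measure.restrict_restrict measurableSet_Iio, Set.Iio_inter_Ioi]
    exact integrableOn_const (by simp)
  refine hone.congr_fun (fun r hr => ?_) measurableSet_Ioi
  have hr0 : r ≠ 0 := ne_of_gt hr
  by_cases h : r < 1 <;> simp [Set.indicator, h, hr0]

lemma abs_log_le_log_one_add_add_indicator_inv {r : ℝ} (hr : 0 ≤ r) :
    |Real.log r| ≤ Real.log (1 + r) + (Set.Iio (1 : ℝ)).indicator (fun r => r⁻¹) r := by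
  rcases hr.eq_or_lt with rfl | hr
  · simp
  by_cases h : r < 1
  · have hlog := Real.log_le_sub_one_of_pos (inv_pos.2 hr)
    have hnonneg := Real.log_nonneg (show 1 ≤ 1 + r by linarith)
    rw [Real.log_inv] at hlog
    rw [abs_of_neg (Real.log_neg hr h), Set.indicator_of_mem (Set.mem_Iio.2 h)]
    linarith
  · rw [abs_of_nonneg (Real.log_nonneg (not_lt.1 h)), Set.indicator_of_notMem (by simpa using h),
      add_zero]
    exact Real.log_le_log hr (by linarith)

lemma log_one_add_norm_sub_le {E : Type*} [SeminormedAddCommGroup E] (x y : E) :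
    Real.log (1 + ‖x - y‖) ≤ Real.log (1 + ‖x‖) + Real.log (1 + ‖y‖) := by
  have hx := norm_nonneg x
  have hy := norm_nonneg y
  rw [← Real.log_mul (by positivity) (by positivity)]
  exact Real.log_le_log (by positivity) (by nlinarith [norm_sub_le x y])

/-- The energy `E(u) = ∫|∇u|² + (γ/4π) ∬ ln|x-y| |u(x)|²|u(y)|²` is well
defined (finite) on `X`: since the gradient term is finite by assumption, this
amounts to the integrability of the double integrand. -/
theorem energy_well_defined (γ : ℝ) (hγ : 0 < γ)
    (u : EuclideanSpace ℝ (Fin 2) → ℂ)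
    (hu : Differentiable ℝ u)
    (hL2 : Integrable (fun x => ‖u x‖ ^ 2))
    (hgrad : Integrable (fun x => ‖fderiv ℝ u x‖ ^ 2))
    (hX : Integrable (fun x => Real.log (1 + ‖x‖) * ‖u x‖ ^ 2)) :
    Integrable (fun p : EuclideanSpace ℝ (Fin 2) × EuclideanSpace ℝ (Fin 2) =>
      Real.log ‖p.1 - p.2‖ * ‖u p.1‖ ^ 2 * ‖u p.2‖ ^ 2) := by
  have hL4 := integrable_norm_sq_sq_of_integrable_fderiv hu hL2 hgrad
  have hnear := hL4.convolution_integrand (ContinuousLinearMap.mul ℝ ℝ)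
    integrable_indicator_inv_norm
  have hfar := (hX.mul_prod hL2).add (hL2.mul_prod hX)
  have hmeas : Measurable fun p : EuclideanSpace ℝ (Fin 2) × EuclideanSpace ℝ (Fin 2) =>
      Real.log ‖p.1 - p.2‖ * ‖u p.1‖ ^ 2 * ‖u p.2‖ ^ 2 := by
    have hum : Measurable u := hu.continuous.measurable
    fun_prop
  rw [Measure.volume_eq_prod]
  refine (hfar.add (hnear.add hnear.swap)).mono' hmeas.aestronglyMeasurable
    (Filter.Eventually.of_forall fun p => ?_)
  obtain ⟨x, y⟩ := p
  simp only [Pi.add_apply, Function.comp_apply, Prod.swap_prod_mk, ContinuousLinearMap.mul_apply',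
    norm_sub_rev y x, norm_mul, norm_pow, Real.norm_eq_abs, abs_norm]
  have hlog := (abs_log_le_log_one_add_add_indicator_inv (norm_nonneg (x - y))).trans
    (add_le_add_left (log_one_add_norm_sub_le x y) _)
  have hk : 0 ≤ (Set.Iio (1 : ℝ)).indicator (fun r => r⁻¹) ‖x - y‖ :=
    Set.indicator_apply_nonneg fun _ => inv_nonneg.2 (norm_nonneg _)
  generalize (Set.Iio (1 : ℝ)).indicator (fun r => r⁻¹) ‖x - y‖ = k at *
  have ha : 0 ≤ ‖u x‖ ^ 2 := by positivity
  have hb : 0 ≤ ‖u y‖ ^ 2 := by positivity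
  generalize ‖u x‖ ^ 2 = a at *
  generalize ‖u y‖ ^ 2 = b at *
  have hab : a * b ≤ b ^ 2 + a ^ 2 := by nlinarith [sq_nonneg (a - b), mul_nonneg ha hb]
  calc |Real.log ‖x - y‖| * a * b
      = |Real.log ‖x - y‖| * (a * b) := by ring
    _ ≤ (Real.log (1 + ‖x‖) + Real.log (1 + ‖y‖) + k) * (a * b) :=
        mul_le_mul_of_nonneg_right hlog (mul_nonneg ha hb)
    _ ≤ _ := by linarith [mul_le_mul_of_nonneg_left hab hk]
end

section
/- Let u ∈ X be a nonnegative spherically symmetric function with ∫|u|^2 dx = λ. Then E(u) ≥ ‖∇u‖_2^2 + (γλ/4π)∫ ln(1+|x|) u(x)^2 dx − (γ λ^{3/2}/2π) ‖∇u‖_2. -/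
open MeasureTheory

theorem log_norm_le_circleAverage_log_norm_mul_sub {x : ℂ} (hx : x ≠ 0) (y : ℂ) :
    2 * Real.pi * Real.log ‖x‖ ≤
      ∫ θ in (0 : ℝ)..2 * Real.pi, Real.log ‖circleMap 0 1 θ * x - y‖ := by
  have hxn : ‖x‖ ≠ 0 := norm_ne_zero_iff.2 hx
  have hrot (θ : ℝ) : ‖circleMap 0 1 θ * x - y‖ = ‖circleMap 0 ‖x‖ θ - y * (‖x‖ / x)‖ := by
    have hunit : ‖(‖x‖ / x : ℂ)‖ = 1 := by simp [hxn]
    have hmul : circleMap 0 ‖x‖ θ - y * (‖x‖ / x) = (circleMap 0 1 θ * x - y) * (‖x‖ / x) := by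
      simp only [circleMap]
      field_simp
      push_cast
      ring
    rw [hmul, norm_mul, hunit, mul_one]
  have havg := circleAverage_log_norm_sub_const_eq_log_radius_add_posLog
    (c := 0) (a := y * (‖x‖ / x)) hxn
  rw [Real.circleAverage_def, smul_eq_mul] at havg
  simp_rw [hrot]
  have hle : Real.log ‖x‖ ≤ (2 * Real.pi)⁻¹ *
      ∫ θ in (0 : ℝ)..2 * Real.pi, Real.log ‖circleMap 0 ‖x‖ θ - y * (‖x‖ / x)‖ := by
    rw [havg]
    exact le_add_of_nonneg_right Real.posLog_nonneg
  have hpi : 0 < 2 * Real.pi := by positivity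
  rwa [inv_mul_eq_div, le_div_iff₀' hpi] at hle

/-- A lower bound for the logarithmic interaction of a radial density on the plane,
coming from Newton's theorem. -/
theorem integral_mul_integral_log_norm_le {f : ℂ → ℝ} (hf : Measurable f)
    (hf0 : ∀ z, 0 ≤ f z) (hrad : ∀ z w, ‖z‖ = ‖w‖ → f z = f w) (hint : Integrable f)
    (hlog : Integrable fun z => Real.log ‖z‖ * f z)
    (hV : Integrable fun p : ℂ × ℂ => Real.log ‖p.1 - p.2‖ * f p.1 * f p.2) :
    (∫ z, f z) * ∫ z, Real.log ‖z‖ * f z ≤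
      ∫ p : ℂ × ℂ, Real.log ‖p.1 - p.2‖ * f p.1 * f p.2 := by
  set H : ℂ × ℂ → ℝ := fun p => Real.log ‖p.1 - p.2‖ * f p.1 * f p.2 with hH
  set G : ℝ → ℂ × ℂ → ℝ := fun θ p => H (circleMap 0 1 θ * p.1, p.2) with hG
  have hGf (θ : ℝ) (p : ℂ × ℂ) :
      G θ p = Real.log ‖circleMap 0 1 θ * p.1 - p.2‖ * (f p.1 * f p.2) := by
    simp only [hG, hH]
    rw [hrad (circleMap 0 1 θ * p.1) p.1 (by simp), mul_assoc]
  have hHm : Measurable H := by fun_prop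
  have hmp (θ : ℝ) : MeasurePreserving
      (fun p : ℂ × ℂ => (circleMap 0 1 θ * p.1, p.2)) := by
    have h1 : MeasurePreserving (fun z : ℂ => circleMap 0 1 θ * z) :=
      (rotation ⟨circleMap 0 1 θ, by simp [Submonoid.unitSphere]⟩).measurePreserving
    exact h1.prod (MeasurePreserving.id volume)
  have hGi (θ : ℝ) : Integrable (G θ) := (hmp θ).integrable_comp_of_integrable hV
  have hcomp (g : ℂ × ℂ → ℝ) (hg : Measurable g) (θ : ℝ) :
      ∫ p : ℂ × ℂ, g (circleMap 0 1 θ * p.1, p.2) = ∫ p, g p := by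
    have h := (hmp θ).map_eq
    conv_rhs => rw [← h]
    rw [integral_map (hmp θ).measurable.aemeasurable hg.aestronglyMeasurable]
  set μ : Measure ℝ := volume.restrict (Set.uIoc 0 (2 * Real.pi)) with hμ
  have hcirc : Measurable (circleMap 0 1) := (continuous_circleMap 0 1).measurable
  have hGm : Measurable (Function.uncurry G) := by
    have : Measurable fun q : ℝ × (ℂ × ℂ) => (circleMap 0 1 q.1 * q.2.1, q.2.2) := by fun_prop
    exact hHm.comp this
  have hGI : Integrable (Function.uncurry G) (μ.prod volume) := by
    rw [integrable_prod_iff hGm.aestronglyMeasurable]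
    refine ⟨.of_forall hGi, ?_⟩
    have hconst (θ : ℝ) : ∫ p, ‖Function.uncurry G (θ, p)‖ = ∫ p, ‖H p‖ :=
      hcomp (fun p => ‖H p‖) hHm.norm θ
    simp_rw [hconst]
    have : IsFiniteMeasure μ := by
      rw [hμ, Set.uIoc]
      infer_instance
    exact integrable_const _
  have hswap := intervalIntegral_integral_swap hGI
  have hleft : ∫ θ in (0 : ℝ)..2 * Real.pi, ∫ p, G θ p = 2 * Real.pi * ∫ p, H p := by
    have hconst (θ : ℝ) : ∫ p, G θ p = ∫ p, H p := hcomp H hHm θ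
    simp [hconst]
  have hfst : ∀ᵐ p : ℂ × ℂ, p.1 ≠ 0 :=
    Measure.quasiMeasurePreserving_fst.ae (Measure.ae_ne volume (0 : ℂ))
  have hle : ∫ p : ℂ × ℂ, 2 * Real.pi * ((Real.log ‖p.1‖ * f p.1) * f p.2) ≤
      ∫ p, ∫ θ in (0 : ℝ)..2 * Real.pi, G θ p := by
    refine integral_mono_ae ((hlog.mul_prod hint).const_mul _) ?_ ?_
    · simp_rw [intervalIntegral.integral_of_le Real.two_pi_pos.le]
      rw [hμ, Set.uIoc_of_le Real.two_pi_pos.le] at hGI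
      exact hGI.integral_prod_right
    · filter_upwards [hfst] with p hp
      simp_rw [hGf, intervalIntegral.integral_mul_const]
      have := mul_le_mul_of_nonneg_right (log_norm_le_circleAverage_log_norm_mul_sub hp p.2)
        (mul_nonneg (hf0 p.1) (hf0 p.2))
      linarith
  rw [← hswap, hleft, integral_const_mul] at hle
  have hprod := integral_prod_mul (μ := volume) (ν := volume)
    (fun z : ℂ => Real.log ‖z‖ * f z) f
  rw [← Measure.volume_eq_prod] at hprod
  rw [hprod, mul_comm (∫ z, Real.log ‖z‖ * f z)] at hle
  exact le_of_mul_le_mul_left hle Real.two_pi_pos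

theorem integral_Ioi_sq_eq_neg_integral_mul_deriv {ψ : ℝ → ℝ} (hψ : Differentiable ℝ ψ)
    (hsq : IntegrableOn (fun r => r * ψ r ^ 2) (Set.Ioi 0))
    (hderiv : IntegrableOn (fun r => r * (ψ r * deriv ψ r)) (Set.Ioi 0)) :
    IntegrableOn (fun r => ψ r ^ 2) (Set.Ioi 0) ∧
      ∫ r in Set.Ioi 0, ψ r ^ 2 = -2 * ∫ r in Set.Ioi 0, r * (ψ r * deriv ψ r) := by
  have hcont : Continuous fun r => ψ r ^ 2 := hψ.continuous.pow 2
  have hnear : IntegrableOn (fun r => ψ r ^ 2) (Set.Ioc 0 1) :=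
    hcont.integrableOn_Icc.mono_set Set.Ioc_subset_Icc_self
  have hfar : IntegrableOn (fun r => ψ r ^ 2) (Set.Ioi 1) := by
    refine (hsq.mono_set (Set.Ioi_subset_Ioi zero_le_one)).mono'
      hcont.aestronglyMeasurable ?_
    filter_upwards [ae_restrict_mem measurableSet_Ioi] with r hr
    rw [Real.norm_of_nonneg (sq_nonneg _)]
    exact le_mul_of_one_le_left (sq_nonneg _) (le_of_lt hr)
  have hint : IntegrableOn (fun r => ψ r ^ 2) (Set.Ioi 0) := by
    rw [← Set.Ioc_union_Ioi_eq_Ioi zero_le_one]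
    exact hnear.union hfar
  have hd (r : ℝ) : HasDerivAt (fun r => r * ψ r ^ 2)
      (ψ r ^ 2 + 2 * (r * (ψ r * deriv ψ r))) r := by
    convert! (hasDerivAt_id r).mul ((hψ r).hasDerivAt.pow 2) using 1
    simp
    ring
  have hdint := hint.add (hderiv.const_mul 2)
  have hlim := tendsto_zero_of_hasDerivAt_of_integrableOn_Ioi (fun r _ => hd r) hdint hsq
  have h := integral_Ioi_of_hasDerivAt_of_tendsto' (fun r _ => hd r) hdint hlim
  rw [integral_add hint (hderiv.const_mul 2), integral_const_mul] at h
  refine ⟨hint, ?_⟩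
  linarith

section Radial

variable {E : Type*} [NormedAddCommGroup E] [NormedSpace ℝ E]

theorem norm_deriv_le_norm_fderiv_of_radial {u : E → ℝ} {ψ : ℝ → ℝ}
    (hrad : ∀ x, u x = ψ ‖x‖) {x : E} (hx : x ≠ 0) (hu : DifferentiableAt ℝ u x) :
    ‖deriv ψ ‖x‖‖ ≤ ‖fderiv ℝ u x‖ := by
  have hxn : 0 < ‖x‖ := norm_pos_iff.2 hx
  set v : E := ‖x‖⁻¹ • x with hv
  have hv1 : ‖v‖ = 1 := by simp [hv, norm_smul, hxn.ne']
  have hxv : ‖x‖ • v = x := by simp [hv, smul_smul, hxn.ne']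
  have hline : HasDerivAt (fun r : ℝ => r • v) v ‖x‖ := by
    simpa using (hasDerivAt_id ‖x‖).smul_const v
  have hcomp : HasDerivAt (fun r : ℝ => u (r • v)) (fderiv ℝ u x v) ‖x‖ := by
    refine HasFDerivAt.comp_hasDerivAt ‖x‖ ?_ hline
    rw [hxv]
    exact hu.hasFDerivAt
  have heq : (fun r : ℝ => u (r • v)) =ᶠ[nhds ‖x‖] ψ := by
    filter_upwards [lt_mem_nhds hxn] with r hr
    rw [hrad, norm_smul, hv1, mul_one, Real.norm_of_nonneg hr.le]
  rw [(hcomp.congr_of_eventuallyEq heq.symm).deriv]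
  simpa [hv1] using (fderiv ℝ u x).le_opNorm v

variable [FiniteDimensional ℝ E] [MeasurableSpace E] [BorelSpace E]

/-- The Hardy-type inequality `∫ u² / |x| ≤ 2 ‖u‖₂ ‖∇u‖₂` for radial functions in the plane. -/
theorem integral_inv_norm_mul_sq_le_of_radial (μ : Measure E) [μ.IsAddHaarMeasure]
    (hE : Module.finrank ℝ E = 2) {u : E → ℝ} {ψ : ℝ → ℝ}
    (hψ : Differentiable ℝ ψ) (hrad : ∀ x, u x = ψ ‖x‖) (hu : Differentiable ℝ u)
    (hsq : Integrable (fun x => u x ^ 2) μ)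
    (hgrad : Integrable (fun x => ‖fderiv ℝ u x‖ ^ 2) μ) :
    Integrable (fun x => ‖x‖⁻¹ * u x ^ 2) μ ∧
      ∫ x, ‖x‖⁻¹ * u x ^ 2 ∂μ ≤
        2 * (√(∫ x, u x ^ 2 ∂μ) * √(∫ x, ‖fderiv ℝ u x‖ ^ 2 ∂μ)) := by
  have : Nontrivial E := Module.nontrivial_of_finrank_pos (R := ℝ) (by omega)
  have hum : AEStronglyMeasurable u μ := hu.continuous.aestronglyMeasurable
  have hdm : Measurable (fun x : E => deriv ψ ‖x‖) :=
    (measurable_deriv ψ).comp measurable_norm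
  have hbound : ∀ᵐ x ∂μ, ‖deriv ψ ‖x‖‖ ≤ ‖fderiv ℝ u x‖ := by
    filter_upwards [Measure.ae_ne μ (0 : E)] with x hx
    exact norm_deriv_le_norm_fderiv_of_radial hrad hx (hu x)
  have hsq_bound : ∀ᵐ x ∂μ, deriv ψ ‖x‖ ^ 2 ≤ ‖fderiv ℝ u x‖ ^ 2 := by
    filter_upwards [hbound] with x hx
    rw [← sq_abs]
    exact pow_le_pow_left₀ (abs_nonneg _) hx 2
  have hdsq : Integrable (fun x => deriv ψ ‖x‖ ^ 2) μ := by
    refine hgrad.mono' (hdm.pow_const 2).aestronglyMeasurable ?_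
    filter_upwards [hsq_bound] with x hx
    rwa [Real.norm_of_nonneg (sq_nonneg _)]
  have huL : MemLp u 2 μ := (memLp_two_iff_integrable_sq hum).2 hsq
  have hdL : MemLp (fun x => deriv ψ ‖x‖) 2 μ :=
    (memLp_two_iff_integrable_sq hdm.aestronglyMeasurable).2 hdsq
  have hprod : Integrable (fun x => ψ ‖x‖ * deriv ψ ‖x‖) μ := by
    simp_rw [← hrad]
    exact huL.integrable_mul hdL
  have hCS : ∫ x, ‖u x‖ * ‖deriv ψ ‖x‖‖ ∂μ ≤
      √(∫ x, u x ^ 2 ∂μ) * √(∫ x, ‖fderiv ℝ u x‖ ^ 2 ∂μ) := by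
    have h := integral_mul_norm_le_Lp_mul_Lq (μ := μ) Real.HolderConjugate.two_two
      (f := u) (g := fun x => deriv ψ ‖x‖) (by simpa using huL) (by simpa using hdL)
    simp only [Real.rpow_two, Real.norm_eq_abs, sq_abs, ← Real.sqrt_eq_rpow] at h
    exact h.trans (mul_le_mul_of_nonneg_left
      (Real.sqrt_le_sqrt (integral_mono_ae hdsq hgrad hsq_bound)) (Real.sqrt_nonneg _))
  have hsq1 : IntegrableOn (fun r => r * ψ r ^ 2) (Set.Ioi 0) := by
    simp_rw [hrad] at hsq
    simpa [hE] using (integrable_fun_norm_addHaar μ (f := fun r => ψ r ^ 2)).1 hsq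
  have hprod1 : IntegrableOn (fun r => r * (ψ r * deriv ψ r)) (Set.Ioi 0) := by
    simpa [hE] using (integrable_fun_norm_addHaar μ (f := fun r => ψ r * deriv ψ r)).1 hprod
  obtain ⟨hint, heq⟩ := integral_Ioi_sq_eq_neg_integral_mul_deriv hψ hsq1 hprod1
  have hcancel : Set.EqOn (fun r => r * (r⁻¹ * ψ r ^ 2)) (fun r => ψ r ^ 2) (Set.Ioi 0) := by
    intro r hr
    have : r ≠ 0 := ne_of_gt hr
    simp only
    field_simp
  have hI : Integrable (fun x => ‖x‖⁻¹ * u x ^ 2) μ := by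
    simp_rw [hrad]
    refine (integrable_fun_norm_addHaar μ (f := fun r => r⁻¹ * ψ r ^ 2)).2 ?_
    simp only [hE, Nat.add_one_sub_one, pow_one, smul_eq_mul]
    exact hint.congr_fun hcancel.symm measurableSet_Ioi
  have hpolar : ∫ x, ‖x‖⁻¹ * u x ^ 2 ∂μ = -2 * ∫ x, ψ ‖x‖ * deriv ψ ‖x‖ ∂μ := by
    simp_rw [hrad]
    rw [integral_fun_norm_addHaar μ (fun r => r⁻¹ * ψ r ^ 2),
      integral_fun_norm_addHaar μ (fun r => ψ r * deriv ψ r)]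
    simp only [hE, Nat.add_one_sub_one, pow_one, smul_eq_mul]
    rw [setIntegral_congr_fun measurableSet_Ioi hcancel, heq]
    simp only [nsmul_eq_mul]
    ring
  refine ⟨hI, ?_⟩
  have habs := norm_integral_le_integral_norm (μ := μ) (fun x => ψ ‖x‖ * deriv ψ ‖x‖)
  simp only [norm_mul, ← hrad] at habs
  rw [hpolar]
  simp only [← hrad]
  have hneg := neg_abs_le (∫ x, u x * deriv ψ ‖x‖ ∂μ)
  rw [Real.norm_eq_abs] at habs
  linarith

end Radial

theorem log_one_add_le_log_add_inv {r : ℝ} (hr : 0 ≤ r) :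
    Real.log (1 + r) ≤ Real.log r + r⁻¹ := by
  rcases hr.eq_or_lt with rfl | hr
  · simp
  · have h := Real.log_le_sub_one_of_pos (x := (1 + r) / r) (by positivity)
    rw [Real.log_div (by positivity) hr.ne'] at h
    have : (1 + r) / r - 1 = r⁻¹ := by
      field_simp
      ring
    linarith

theorem log_le_log_one_add {r : ℝ} (hr : 0 ≤ r) : Real.log r ≤ Real.log (1 + r) := by
  rcases hr.eq_or_lt with rfl | hr
  · simp
  · exact Real.log_le_log hr (by linarith)

/-- The lower bound for the logarithmic interaction, transported from `ℂ` to the Euclidean plane. -/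
theorem integral_mul_integral_log_norm_le_euclideanSpace
    {f : EuclideanSpace ℝ (Fin 2) → ℝ} (hf : Measurable f)
    (hf0 : ∀ z, 0 ≤ f z) (hrad : ∀ z w, ‖z‖ = ‖w‖ → f z = f w) (hint : Integrable f)
    (hlog : Integrable fun z => Real.log ‖z‖ * f z)
    (hV : Integrable fun p : EuclideanSpace ℝ (Fin 2) × EuclideanSpace ℝ (Fin 2) =>
      Real.log ‖p.1 - p.2‖ * f p.1 * f p.2) :
    (∫ z, f z) * ∫ z, Real.log ‖z‖ * f z ≤
      ∫ p : EuclideanSpace ℝ (Fin 2) × EuclideanSpace ℝ (Fin 2),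
        Real.log ‖p.1 - p.2‖ * f p.1 * f p.2 := by
  let e : ℂ ≃ₗᵢ[ℝ] EuclideanSpace ℝ (Fin 2) := Complex.orthonormalBasisOneI.repr
  have he : MeasurePreserving e := e.measurePreserving
  have hee : MeasurePreserving (Prod.map e e) := he.prod he
  have hemb : MeasurableEmbedding e := e.toHomeomorph.measurableEmbedding
  have heemb : MeasurableEmbedding (Prod.map e e) :=
    (e.toHomeomorph.prodCongr e.toHomeomorph).measurableEmbedding
  have hsub (z w : ℂ) : ‖e z - e w‖ = ‖z - w‖ := by rw [← map_sub, e.norm_map]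
  have h := integral_mul_integral_log_norm_le (f := fun z => f (e z)) (hf.comp he.measurable)
    (fun z => hf0 _) (fun z w hzw => hrad _ _ (by simpa using hzw))
    (he.integrable_comp_of_integrable hint)
    (by simpa [Function.comp_def] using he.integrable_comp_of_integrable hlog)
    (by simpa [Function.comp_def, hsub] using hee.integrable_comp_of_integrable hV)
  rw [← he.integral_comp hemb, ← he.integral_comp hemb, ← hee.integral_comp heemb]
  simpa [hsub] using h

theorem energy_lower_bound_radial (γ : ℝ) (hγ : 0 < γ)
    (u : EuclideanSpace ℝ (Fin 2) → ℝ) (lam : ℝ) (φ : ℝ → ℝ)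
    (hrad : ∀ x, u x = φ ‖x‖) (hnonneg : ∀ x, 0 ≤ u x)
    (hu : Differentiable ℝ u)
    (hL2 : Integrable (fun x => u x ^ 2))
    (hlam : (∫ x, u x ^ 2) = lam)
    (hgrad : Integrable (fun x => ‖fderiv ℝ u x‖ ^ 2))
    (hX : Integrable (fun x => Real.log (1 + ‖x‖) * u x ^ 2))
    (hV : Integrable (fun p : EuclideanSpace ℝ (Fin 2) × EuclideanSpace ℝ (Fin 2) =>
      Real.log ‖p.1 - p.2‖ * u p.1 ^ 2 * u p.2 ^ 2)) :
    (∫ x, ‖fderiv ℝ u x‖ ^ 2) + (γ / 2) * ((1 / (2 * Real.pi)) *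
        ∫ p : EuclideanSpace ℝ (Fin 2) × EuclideanSpace ℝ (Fin 2),
          Real.log ‖p.1 - p.2‖ * u p.1 ^ 2 * u p.2 ^ 2)
      ≥ (∫ x, ‖fderiv ℝ u x‖ ^ 2)
        + (γ * lam / (4 * Real.pi)) * (∫ x, Real.log (1 + ‖x‖) * u x ^ 2)
        - (γ * lam ^ ((3 : ℝ) / 2) / (2 * Real.pi)) *
            Real.sqrt (∫ x, ‖fderiv ℝ u x‖ ^ 2) := by
  obtain ⟨e, he⟩ := exists_norm_eq (EuclideanSpace ℝ (Fin 2)) zero_le_one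
  have hψrad (x : EuclideanSpace ℝ (Fin 2)) : u x = u (‖x‖ • e) := by
    rw [hrad, hrad (‖x‖ • e)]
    simp [norm_smul, he]
  obtain ⟨hinv, hhardy⟩ := integral_inv_norm_mul_sq_le_of_radial volume (by simp)
    (ψ := fun r => u (r • e)) (by fun_prop) hψrad hu hL2 hgrad
  have hlower (x : EuclideanSpace ℝ (Fin 2)) :
      Real.log (1 + ‖x‖) * u x ^ 2 - ‖x‖⁻¹ * u x ^ 2 ≤ Real.log ‖x‖ * u x ^ 2 := by
    rw [← sub_mul]
    have := log_one_add_le_log_add_inv (norm_nonneg x)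
    exact mul_le_mul_of_nonneg_right (by linarith) (sq_nonneg _)
  have hupper (x : EuclideanSpace ℝ (Fin 2)) :
      Real.log ‖x‖ * u x ^ 2 ≤ Real.log (1 + ‖x‖) * u x ^ 2 :=
    mul_le_mul_of_nonneg_right (log_le_log_one_add (norm_nonneg x)) (sq_nonneg _)
  have hum : Measurable u := hu.continuous.measurable
  have hlog : Integrable (fun x => Real.log ‖x‖ * u x ^ 2) :=
    integrable_of_le_of_le (by fun_prop) (.of_forall hlower) (.of_forall hupper)
      (hX.sub hinv) hX
  have hlogle := integral_mono (hX.sub hinv) hlog hlower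
  have hnewton := integral_mul_integral_log_norm_le_euclideanSpace (f := fun x => u x ^ 2)
    (hum.pow_const 2) (fun x => sq_nonneg _)
    (fun z w hzw => by rw [hrad, hrad w, hzw]) hL2 hlog hV
  simp only [Pi.sub_apply] at hlogle
  rw [integral_sub hX hinv] at hlogle
  have hlam0 : 0 ≤ lam := hlam ▸ integral_nonneg fun x => sq_nonneg (u x)
  have hpow : lam ^ ((3 : ℝ) / 2) = lam * √lam := by
    rw [Real.sqrt_eq_rpow, show (3 : ℝ) / 2 = 1 + 1 / 2 by norm_num,
      Real.rpow_add_of_nonneg hlam0 zero_le_one (by norm_num), Real.rpow_one]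
  rw [hlam] at hnewton hhardy
  rw [hpow]
  set L := ∫ x, Real.log (1 + ‖x‖) * u x ^ 2
  set T := ∫ x, ‖fderiv ℝ u x‖ ^ 2
  set V := ∫ p : EuclideanSpace ℝ (Fin 2) × EuclideanSpace ℝ (Fin 2),
    Real.log ‖p.1 - p.2‖ * u p.1 ^ 2 * u p.2 ^ 2
  have hV_ge : lam * (L - 2 * (√lam * √T)) ≤ V :=
    (mul_le_mul_of_nonneg_left (by linarith) hlam0).trans hnewton
  have hscaled := mul_le_mul_of_nonneg_left hV_ge
    (show 0 ≤ γ / (4 * Real.pi) by positivity)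
  have hl : γ / 2 * (1 / (2 * Real.pi) * V) = γ / (4 * Real.pi) * V := by
    field_simp
    ring
  have hr : γ * lam / (4 * Real.pi) * L - γ * (lam * √lam) / (2 * Real.pi) * √T =
      γ / (4 * Real.pi) * (lam * (L - 2 * (√lam * √T))) := by
    field_simp
    ring
  linarith
end
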